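/- Let d ≥ 1 and let V : ℤ^d → ℝ satisfy ‖V‖_∞ ≤ V_∞ < ∞. There exist constants C > 0 and L₀ > 0, depending only on d and V_∞, with the following property: for every 0 < ε ≤ 1/2, every E ∈ ℝ, every x₀ ∈ ℤ^d, every L ≥ L₀ · log(1/ε), and every linear subspace F of ℓ²(Λ), Λ = Λ_L(x₀), such that ‖H_Λψ − Eψ‖_{ℓ²(Λ)} ≤ ε‖ψ‖_{ℓ²(Λ)} for all ψ ∈ F, one has dim F ≤ C · |Λ| / log(1/ε). -/

import Mathlib

noncomputable section

/-- The discrete box `Λ_L(x₀) = {y ∈ ℤ^d : ‖y - x₀‖_∞ ≤ L/2}`, as a finite set.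
(For an integer `k` one has `|k| ≤ L/2 ↔ |k| ≤ ⌊L/2⌋`.) -/
def boxZ (d : ℕ) (x₀ : Fin d → ℤ) (L : ℝ) : Finset (Fin d → ℤ) :=
  Fintype.piFinset fun i => Finset.Icc (x₀ i - ⌊L / 2⌋) (x₀ i + ⌊L / 2⌋)

/-- The matrix of the finite-volume discrete Schrödinger operator `H_Λ = -Δ_Λ + V` with
Dirichlet (simple) boundary condition:
`(H_Λ ψ)(x) = -∑_{y ∈ Λ, ‖x-y‖₁ = 1} ψ(y) + V(x) ψ(x)` for `x ∈ Λ`. -/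
def hamMat (d : ℕ) (V : (Fin d → ℤ) → ℝ) (Λ : Finset (Fin d → ℤ)) :
    Matrix ↥Λ ↥Λ ℂ := fun x y =>
  (if (∑ i, |x.1 i - y.1 i|) = 1 then -1 else 0) + (if x = y then (V x.1 : ℂ) else 0)

/-- The finite-volume operator `H_Λ` acting on `ℓ²(Λ)`. -/
def ham (d : ℕ) (V : (Fin d → ℤ) → ℝ) (Λ : Finset (Fin d → ℤ)) :
    (↥Λ → ℂ) →ₗ[ℂ] (↥Λ → ℂ) :=
  Matrix.toLin' (hamMat d V Λ)


end

open Finset in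
/-- Cauchy-Schwarz for a sum with at most `D` terms. -/
lemma norm_sum_sq_le_mul_sum_norm_sq {α : Type*} (s : Finset α) (f : α → ℂ) {D : ℝ}
    (hD : (#s : ℝ) ≤ D) : ‖∑ y ∈ s, f y‖ ^ 2 ≤ D * ∑ y ∈ s, ‖f y‖ ^ 2 := by
  calc ‖∑ y ∈ s, f y‖ ^ 2 ≤ (∑ y ∈ s, ‖f y‖) ^ 2 := by
        gcongr
        exact norm_sum_le _ _
    _ ≤ #s * ∑ y ∈ s, ‖f y‖ ^ 2 := sq_sum_le_card_mul_sum_sq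
    _ ≤ D * ∑ y ∈ s, ‖f y‖ ^ 2 := by gcongr

open Finset in
/-- Summing a nonnegative function over all neighbourhoods counts each point at most `D` times. -/
lemma sum_sum_filter_le_mul_sum {α : Type*} [Fintype α] (K : α → α → Prop)
    [∀ x y, Decidable (K x y)] {D : ℝ} (hcol : ∀ y, (#{x | K x y} : ℝ) ≤ D)
    (g : α → ℝ) (hg : ∀ x, 0 ≤ g x) :
    ∑ x, ∑ y with K x y, g y ≤ D * ∑ y, g y := by
  simp_rw [sum_filter]
  rw [sum_comm, mul_sum]
  refine sum_le_sum fun y _ => ?_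
  rw [← sum_filter, sum_const, nsmul_eq_mul]
  exact mul_le_mul_of_nonneg_right (hcol y) (hg y)

open Finset in
/-- An approximate solution of `-∑_{y ∼ x} ψ y + u x * ψ x = 0` with large `u` vanishes. -/
lemma eq_zero_of_large_potential {α : Type*} [Fintype α] (K : α → α → Prop)
    [∀ x y, Decidable (K x y)] {D : ℝ} (hD : 1 ≤ D)
    (hrow : ∀ x, (#{y | K x y} : ℝ) ≤ D) (hcol : ∀ y, (#{x | K x y} : ℝ) ≤ D)
    (u ψ η : α → ℂ) (hη : ∀ x, η x = -∑ y with K x y, ψ y + u x * ψ x)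
    (hu : ∀ x, 2 * D < ‖u x‖) {ε : ℝ} (hε0 : 0 < ε) (hε : ε ≤ 1 / 2)
    (hsmall : ∑ x, ‖η x‖ ^ 2 ≤ ε ^ 2 * ∑ x, ‖ψ x‖ ^ 2) : ψ = 0 := by
  have hpt : ∀ x, (2 * D) ^ 2 * ‖ψ x‖ ^ 2 ≤
      2 * ‖η x‖ ^ 2 + 2 * (D * ∑ y with K x y, ‖ψ y‖ ^ 2) := fun x => by
    have h1 : ‖u x * ψ x‖ ≤ ‖η x‖ + ‖∑ y with K x y, ψ y‖ := by
      have : u x * ψ x = η x + ∑ y with K x y, ψ y := by rw [hη]; ring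
      rw [this]
      exact norm_add_le _ _
    have h2 := norm_sum_sq_le_mul_sum_norm_sq _ ψ (hrow x)
    have h3 : ‖u x * ψ x‖ ^ 2 ≤ (‖η x‖ + ‖∑ y with K x y, ψ y‖) ^ 2 := by gcongr
    have h4 : (2 * D) ^ 2 * ‖ψ x‖ ^ 2 ≤ ‖u x * ψ x‖ ^ 2 := by
      rw [norm_mul, mul_pow ‖u x‖]
      exact mul_le_mul_of_nonneg_right (pow_le_pow_left₀ (by linarith) (hu x).le 2)
        (by positivity)
    nlinarith [sq_nonneg (‖η x‖ - ‖∑ y with K x y, ψ y‖)]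
  have hsum := sum_le_sum fun x (_ : x ∈ univ) => hpt x
  rw [sum_add_distrib, ← mul_sum, ← mul_sum, ← mul_sum, ← mul_sum] at hsum
  have hK := sum_sum_filter_le_mul_sum K hcol (fun y => ‖ψ y‖ ^ 2) fun _ => by positivity
  have hT : 0 ≤ ∑ x, ‖ψ x‖ ^ 2 := sum_nonneg fun _ _ => by positivity
  have hK' := mul_le_mul_of_nonneg_left hK (show 0 ≤ D by linarith)
  have hε2 : ε ^ 2 ≤ 1 / 4 := by nlinarith
  have hεT := mul_le_mul_of_nonneg_right hε2 hT
  have hDT := mul_le_mul_of_nonneg_right (show 1 ≤ D * D by nlinarith) hT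
  have h0 : ∑ x, ‖ψ x‖ ^ 2 = 0 := by nlinarith
  funext x
  simpa using (sum_eq_zero_iff_of_nonneg fun _ _ => by positivity).1 h0 x (mem_univ x)

open Finset in
/-- Quantitative unique continuation: an approximate solution of `-∑_{y ∼ x} ψ y + u x * ψ x = 0`
vanishes if each point of its support is the unique neighbour of maximal rank of some point
of lower rank. -/
lemma eq_zero_of_rank {α : Type*} [Fintype α] (K : α → α → Prop)
    [∀ x y, Decidable (K x y)] {D A q ε : ℝ} {l : ℕ}
    (hrow : ∀ x, (#{y | K x y} : ℝ) ≤ D) (hcol : ∀ y, (#{x | K x y} : ℝ) ≤ D)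
    (u ψ η : α → ℂ) (hη : ∀ x, η x = -∑ y with K x y, ψ y + u x * ψ x)
    (hu : ∀ x, ‖u x‖ ≤ A) (r : α → ℕ) (hr : ∀ x, r x ≤ l)
    (hpred : ∀ z, ψ z ≠ 0 → ∃ x, K x z ∧ r x < r z ∧ ∀ y, y ≠ z → K x y → r y < r z)
    (hq0 : 0 < q) (hq1 : q ≤ 1) (hD : 0 ≤ D) (hq : q * (6 * (A ^ 2 + D ^ 2)) ≤ 1)
    (hε : 6 * ε ^ 2 < q ^ l)
    (hsmall : ∑ x, ‖η x‖ ^ 2 ≤ ε ^ 2 * ∑ x, ‖ψ x‖ ^ 2) : ψ = 0 := by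
  classical
  choose! p hpK hpr hpy using hpred
  set w : α → ℝ := fun x => q ^ r x * ‖ψ x‖ ^ 2 with hw
  have hw0 : ∀ x, 0 ≤ w x := fun x => by positivity
  have hqlt : ∀ x z, r x < r z → q ^ r z ≤ q * q ^ r x := fun x z h => by
    rw [← pow_succ']
    exact pow_le_pow_of_le_one hq0.le hq1 h
  set G : α → ℝ := fun x =>
    3 * q * A ^ 2 * w x + 3 * ‖η x‖ ^ 2 + 3 * q * D * ∑ y with K x y, w y with hG
  have hG0 : ∀ x, 0 ≤ G x := fun x => by
    have := sum_nonneg fun y (_ : y ∈ univ.filter (K x)) => hw0 y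
    have := hw0 x
    positivity
  have hpt : ∀ z, ψ z ≠ 0 → w z ≤ G (p z) := fun z hz => by
    set x := p z
    have hzmem : z ∈ univ.filter (K x) := by simpa using hpK z hz
    have hsplit := add_sum_erase _ ψ hzmem
    have heq : ψ z = u x * ψ x - η x - ∑ y ∈ (univ.filter (K x)).erase z, ψ y := by
      rw [hη, ← hsplit]; ring
    have hcard : (#((univ.filter (K x)).erase z) : ℝ) ≤ D :=
      le_trans (by exact_mod_cast card_le_card (erase_subset _ _)) (hrow x)
    have hCS := norm_sum_sq_le_mul_sum_norm_sq _ ψ hcard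
    have hn : ‖ψ z‖ ≤ ‖u x * ψ x‖ + ‖η x‖ + ‖∑ y ∈ (univ.filter (K x)).erase z, ψ y‖ := by
      conv_lhs => rw [heq]
      exact (norm_sub_le _ _).trans (by gcongr; exact norm_sub_le _ _)
    have hux : ‖u x * ψ x‖ ^ 2 ≤ A ^ 2 * ‖ψ x‖ ^ 2 := by
      rw [norm_mul, mul_pow]
      gcongr
      exact hu x
    have hsq : ‖ψ z‖ ^ 2 ≤ 3 * (A ^ 2 * ‖ψ x‖ ^ 2) + 3 * ‖η x‖ ^ 2 +
        3 * (D * ∑ y ∈ (univ.filter (K x)).erase z, ‖ψ y‖ ^ 2) := by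
      have h := pow_le_pow_left₀ (norm_nonneg _) hn 2
      generalize ‖u x * ψ x‖ = a at *
      generalize ‖∑ y ∈ (univ.filter (K x)).erase z, ψ y‖ = c at *
      nlinarith [sq_nonneg (a - ‖η x‖), sq_nonneg (a - c), sq_nonneg (‖η x‖ - c)]
    have hsum : q ^ r z * ∑ y ∈ (univ.filter (K x)).erase z, ‖ψ y‖ ^ 2 ≤
        q * ∑ y with K x y, w y := by
      rw [mul_sum, mul_sum]
      calc ∑ y ∈ (univ.filter (K x)).erase z, q ^ r z * ‖ψ y‖ ^ 2
          ≤ ∑ y ∈ (univ.filter (K x)).erase z, q * w y := by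
            refine sum_le_sum fun y hy => ?_
            rw [mem_erase, mem_filter] at hy
            have := hqlt y z (hpy z hz y hy.1 hy.2.2)
            simp only [hw, ← mul_assoc]
            gcongr
        _ ≤ _ := sum_le_sum_of_subset_of_nonneg (erase_subset _ _)
            fun y _ _ => mul_nonneg hq0.le (hw0 y)
    have hx : q ^ r z * ‖ψ x‖ ^ 2 ≤ q * w x := by
      simp only [hw, ← mul_assoc]
      have := hqlt x z (hpr z hz)
      gcongr
    have hηx : q ^ r z * ‖η x‖ ^ 2 ≤ ‖η x‖ ^ 2 :=
      mul_le_of_le_one_left (by positivity) (pow_le_one₀ hq0.le hq1)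
    calc w z ≤ q ^ r z * (3 * (A ^ 2 * ‖ψ x‖ ^ 2) + 3 * ‖η x‖ ^ 2 +
          3 * (D * ∑ y ∈ (univ.filter (K x)).erase z, ‖ψ y‖ ^ 2)) := by
          simp only [hw]
          gcongr
      _ = 3 * A ^ 2 * (q ^ r z * ‖ψ x‖ ^ 2) + 3 * (q ^ r z * ‖η x‖ ^ 2) +
          3 * D * (q ^ r z * ∑ y ∈ (univ.filter (K x)).erase z, ‖ψ y‖ ^ 2) := by ring
      _ ≤ 3 * A ^ 2 * (q * w x) + 3 * ‖η x‖ ^ 2 + 3 * D * (q * ∑ y with K x y, w y) := by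
          gcongr
      _ = G x := by rw [hG]; ring
  have hinj : Set.InjOn p (univ.filter fun z => ψ z ≠ 0) := fun z hz z' hz' h => by
    simp only [coe_filter, mem_univ, true_and, Set.mem_ofPred_eq] at hz hz'
    by_contra hne
    have h1 := hpy z hz z' (Ne.symm hne) (h ▸ hpK z' hz')
    have h2 := hpy z' hz' z hne (h ▸ hpK z hz)
    omega
  have hT : ∑ z, w z ≤ ∑ x, G x := by
    calc ∑ z, w z = ∑ z with ψ z ≠ 0, w z := by
          refine (sum_filter_of_ne (p := fun z => ψ z ≠ 0) fun z _ h hz => h ?_).symm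
          simp [hw, hz]
      _ ≤ ∑ z with ψ z ≠ 0, G (p z) := sum_le_sum fun z hz => hpt z (mem_filter.1 hz).2
      _ = ∑ x ∈ (univ.filter fun z => ψ z ≠ 0).image p, G x := (sum_image hinj).symm
      _ ≤ ∑ x, G x := sum_le_sum_of_subset_of_nonneg (subset_univ _) fun x _ _ => hG0 x
  rw [hG, sum_add_distrib, sum_add_distrib, ← mul_sum, ← mul_sum, ← mul_sum] at hT
  have hK := sum_sum_filter_le_mul_sum K hcol w hw0
  have hK' := mul_le_mul_of_nonneg_left hK (show 0 ≤ 3 * q * D by positivity)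
  have hw0' : 0 ≤ ∑ x, w x := sum_nonneg fun x _ => hw0 x
  have hqw := mul_le_mul_of_nonneg_right hq hw0'
  have hψ : q ^ l * ∑ x, ‖ψ x‖ ^ 2 ≤ ∑ x, w x := by
    rw [mul_sum]
    refine sum_le_sum fun x _ => mul_le_mul_of_nonneg_right ?_ (by positivity)
    exact pow_le_pow_of_le_one hq0.le hq1 (hr x)
  have hψ0 : 0 ≤ ∑ x, ‖ψ x‖ ^ 2 := sum_nonneg fun _ _ => by positivity
  have h0 : ∑ x, ‖ψ x‖ ^ 2 = 0 := by nlinarith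
  funext x
  simpa using (sum_eq_zero_iff_of_nonneg fun _ _ => by positivity).1 h0 x (mem_univ x)

/-- Subtracting at most the remainder subtracts from the remainder. -/
lemma Nat.sub_mod_of_le_mod {m l j : ℕ} (hl : 0 < l) (hj : j ≤ m % l) :
    (m - j) % l = m % l - j := by
  have h1 := Nat.div_add_mod m l
  have h2 := Nat.mod_lt m hl
  have h3 : m - j = l * (m / l) + (m % l - j) := by omega
  rw [h3, Nat.mul_add_mod, Nat.mod_eq_of_lt (by omega)]

open Finset in
lemma card_filter_toNat_mod_le (a b : ℤ) (l : ℕ) :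
    #{k ∈ Icc a b | (k - a).toNat % l ≤ 1} ≤ ((b - a).toNat / l + 1) * 2 := by
  have : #(range ((b - a).toNat / l + 1) ×ˢ range 2) = ((b - a).toNat / l + 1) * 2 := by simp
  rw [← this]
  refine card_le_card_of_injOn (fun k => ((k - a).toNat / l, (k - a).toNat % l)) ?_ ?_
  · intro k hk
    simp only [coe_filter, mem_Icc, Set.mem_ofPred_eq] at hk
    simp only [coe_product, Set.mem_prod, coe_range, Set.mem_Iio]
    refine ⟨Nat.lt_succ_of_le (Nat.div_le_div_right ?_), by omega⟩
    omega
  · intro k hk k' hk' h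
    simp only [coe_filter, mem_Icc, Set.mem_ofPred_eq] at hk hk'
    simp only [Prod.mk.injEq] at h
    have h1 := Nat.div_add_mod (k - a).toNat l
    have h2 := Nat.div_add_mod (k' - a).toNat l
    rw [h.1, h.2, h2] at h1
    omega

/-- Nearest neighbours in `ℤ^d`. -/
def latticeAdj {d : ℕ} (x y : Fin d → ℤ) : Prop := ∑ i, |x i - y i| = 1

instance {d : ℕ} (x y : Fin d → ℤ) : Decidable (latticeAdj x y) :=
  inferInstanceAs (Decidable (_ = _))

lemma latticeAdj_comm {d : ℕ} {x y : Fin d → ℤ} : latticeAdj x y ↔ latticeAdj y x := by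
  simp only [latticeAdj, abs_sub_comm]

lemma latticeAdj.abs_sub_le {d : ℕ} {x y : Fin d → ℤ} (h : latticeAdj x y) (i : Fin d) :
    |x i - y i| ≤ 1 :=
  (Finset.single_le_sum (f := fun i => |x i - y i|) (fun _ _ => abs_nonneg _)
    (Finset.mem_univ i)).trans_eq h

lemma latticeAdj.eq_of_ne {d : ℕ} {x y : Fin d → ℤ} (h : latticeAdj x y) {i j : Fin d}
    (hi : y i = x i + 1) (hij : j ≠ i) : y j = x j := by
  have h1 : ∑ k, |x k - y k| = 1 := h
  rw [← Finset.add_sum_erase _ _ (Finset.mem_univ i)] at h1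
  have h2 : |x i - y i| = 1 := by rw [hi]; simp
  have h3 := Finset.single_le_sum (f := fun k => |x k - y k|) (fun _ _ => abs_nonneg _)
    (Finset.mem_erase.2 ⟨hij, Finset.mem_univ j⟩)
  have h4 : |x j - y j| = 0 := le_antisymm (by linarith) (abs_nonneg _)
  rw [abs_eq_zero] at h4
  linarith

open Finset in
lemma card_latticeAdj_le {d : ℕ} (Λ : Finset (Fin d → ℤ)) (x : Λ) :
    #{y : Λ | latticeAdj x.1 y.1} ≤ 3 ^ d := by
  have : #(Fintype.piFinset fun i => Icc (x.1 i - 1) (x.1 i + 1)) = 3 ^ d := by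
    rw [Fintype.card_piFinset]
    have : ∀ i, (x.1 i + 1 + 1 - (x.1 i - 1)).toNat = 3 := fun i => by omega
    simp [this]
  rw [← this]
  refine card_le_card_of_injOn (fun y => y.1) ?_ Subtype.val_injective.injOn
  intro y hy
  simp only [coe_filter, mem_univ, true_and, Set.mem_ofPred_eq] at hy
  simp only [mem_coe, Fintype.mem_piFinset, mem_Icc]
  intro i
  have := abs_le.1 (hy.abs_sub_le i)
  omega

lemma ham_apply {d : ℕ} (V : (Fin d → ℤ) → ℝ) (Λ : Finset (Fin d → ℤ)) (ψ : Λ → ℂ) (x : Λ) :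
    ham d V Λ ψ x = -∑ y : Λ with latticeAdj x.1 y.1, ψ y + V x.1 * ψ x := by
  rw [ham, Matrix.toLin'_apply, Matrix.mulVec, dotProduct]
  simp only [hamMat, ← latticeAdj.eq_1, add_mul, Finset.sum_add_distrib, ite_mul,
    zero_mul, neg_mul, one_mul,
    Finset.sum_ite_eq, Finset.mem_univ, if_true]
  rw [Finset.sum_filter, ← Finset.sum_neg_distrib]
  congr 1
  refine Finset.sum_congr rfl fun y _ => ?_
  by_cases h : latticeAdj x.1 y.1
  · rw [if_pos h, if_pos h]
  · rw [if_neg h, if_neg h, neg_zero]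

/-- Position of `x` in its slab, when the box is cut into slabs of width `l` orthogonal to `i`. -/
def slabRank {d : ℕ} (i : Fin d) (a : ℤ) (l : ℕ) (x : Fin d → ℤ) : ℕ := (x i - a).toNat % l

/-- A point of a box which is not in the first two layers of its slab has a neighbour
from which it can be reached. -/
lemma exists_slab_predecessor {d : ℕ} (i : Fin d) (x₀ : Fin d → ℤ) (L : ℝ) {l : ℕ} (hl : 0 < l)
    (z : boxZ d x₀ L) (hz : 2 ≤ slabRank i (x₀ i - ⌊L / 2⌋) l z.1) :
    ∃ x : boxZ d x₀ L, latticeAdj x.1 z.1 ∧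
      slabRank i (x₀ i - ⌊L / 2⌋) l x.1 < slabRank i (x₀ i - ⌊L / 2⌋) l z.1 ∧
      ∀ y : boxZ d x₀ L, y ≠ z → latticeAdj x.1 y.1 →
        slabRank i (x₀ i - ⌊L / 2⌋) l y.1 < slabRank i (x₀ i - ⌊L / 2⌋) l z.1 := by
  obtain ⟨z, hzΛ⟩ := z
  set a := x₀ i - ⌊L / 2⌋ with ha
  simp only [slabRank] at hz ⊢
  set m := (z i - a).toNat with hm
  have hm2 : 2 ≤ m := hz.trans (Nat.mod_le _ _)
  have hr1 : (m - 1) % l < m % l := by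
    rw [Nat.sub_mod_of_le_mod hl (by omega)]; omega
  have hr2 : (m - 2) % l < m % l := by
    rw [Nat.sub_mod_of_le_mod hl (by omega)]; omega
  have hzbox : ∀ j, x₀ j - ⌊L / 2⌋ ≤ z j ∧ z j ≤ x₀ j + ⌊L / 2⌋ := by
    simpa [boxZ, Fintype.mem_piFinset] using hzΛ
  have hxmem : Function.update z i (z i - 1) ∈ boxZ d x₀ L := by
    simp only [boxZ, Fintype.mem_piFinset, Finset.mem_Icc]
    intro j
    by_cases hj : j = i
    · subst hj
      have := hzbox j
      rw [Function.update_self]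
      omega
    · rw [Function.update_of_ne hj]
      exact hzbox j
  refine ⟨⟨_, hxmem⟩, ?_, ?_, ?_⟩
  · unfold latticeAdj
    rw [Finset.sum_eq_single i]
    · simp
    · intro j _ hj
      simp [Function.update_of_ne hj]
    · simp
  · simp only [Function.update_self]
    rwa [show (z i - 1 - a).toNat = m - 1 by omega]
  · rintro ⟨y, hy⟩ hyz hadj
    have habs := abs_le.1 (hadj.abs_sub_le i)
    simp only [Function.update_self] at habs
    have hne : y i ≠ z i := fun h => hyz <| by
      refine Subtype.ext (funext fun j => ?_)
      by_cases hj : j = i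
      · subst hj; exact h
      · have := hadj.eq_of_ne (i := i) (j := j) (by simp [h]) hj
        simpa only [Function.update_of_ne hj] using this
    have hcase : (y i - a).toNat = m - 1 ∨ (y i - a).toNat = m - 2 := by omega
    simp only
    rcases hcase with h | h <;> rw [h] <;> assumption

open Finset in
/-- The first two layers of the slabs of width `l` take up a fraction of order `1 / l`
of the box. -/
lemma card_slab_layers_mul_le {d : ℕ} (i : Fin d) (x₀ : Fin d → ℤ) (L : ℝ) (l : ℕ) :
    #{x ∈ boxZ d x₀ L | slabRank i (x₀ i - ⌊L / 2⌋) l x ≤ 1} * (2 * ⌊L / 2⌋ + 1).toNat ≤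
      ((2 * ⌊L / 2⌋).toNat / l + 1) * 2 * #(boxZ d x₀ L) := by
  set h := ⌊L / 2⌋ with hh
  set a := x₀ i - h with ha
  have hc := card_filter_toNat_mod_le a (x₀ i + h) l
  rw [show x₀ i + h - a = 2 * h by omega] at hc
  set T := {k ∈ Icc a (x₀ i + h) | (k - a).toNat % l ≤ 1} with hT
  have hsub : {x ∈ boxZ d x₀ L | slabRank i a l x ≤ 1} ⊆
      Fintype.piFinset (Function.update (fun j => Icc (x₀ j - h) (x₀ j + h)) i T) := by
    intro x hx
    simp only [boxZ, mem_filter, Fintype.mem_piFinset] at hx ⊢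
    intro j
    by_cases hj : j = i
    · subst hj
      rw [Function.update_self, hT, mem_filter]
      exact ⟨hx.1 j, hx.2⟩
    · rw [Function.update_of_ne hj]
      exact hx.1 j
  have hcard : ∀ j, #(Icc (x₀ j - h) (x₀ j + h)) = (2 * h + 1).toNat := fun j => by
    rw [Int.card_Icc]; congr 1; ring
  have hprod : #(Fintype.piFinset (Function.update (fun j => Icc (x₀ j - h) (x₀ j + h)) i T)) *
      (2 * h + 1).toNat = #T * #(boxZ d x₀ L) := by
    rw [boxZ, Fintype.card_piFinset, Fintype.card_piFinset,
      ← mul_prod_erase _ _ (mem_univ i), ← mul_prod_erase _ _ (mem_univ i), Function.update_self,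
      hcard i]
    have : ∏ j ∈ univ.erase i,
        #(Function.update (fun j => Icc (x₀ j - h) (x₀ j + h)) i T j) =
        ∏ j ∈ univ.erase i, #(Icc (x₀ j - h) (x₀ j + h)) :=
      prod_congr rfl fun j hj => by rw [Function.update_of_ne (ne_of_mem_erase hj)]
    rw [this]
    ring
  calc _ ≤ _ := Nat.mul_le_mul_right _ (card_le_card hsub)
    _ = _ := hprod
    _ ≤ _ := Nat.mul_le_mul_right _ hc

/-- A space of functions on `Λ` determined by their values where `P` holds has dimension at most
the number of such points. -/
lemma finrank_le_card_filter {β : Type*} (Λ : Finset β) (P : β → Prop) [DecidablePred P]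
    (F : Submodule ℂ (Λ → ℂ))
    (hF : ∀ ψ ∈ F, (∀ x : Λ, P x.1 → ψ x = 0) → ψ = 0) :
    Module.finrank ℂ F ≤ (Λ.filter P).card := by
  let R : F →ₗ[ℂ] (Λ.filter P → ℂ) :=
    LinearMap.funLeft ℂ ℂ (fun x : Λ.filter P => (⟨x.1, (Finset.mem_filter.1 x.2).1⟩ : Λ)) ∘ₗ
      F.subtype
  have hR : Function.Injective R := by
    rw [injective_iff_map_eq_zero]
    intro ψ h
    refine Subtype.ext (hF ψ ψ.2 fun x hx => ?_)
    exact congrFun h ⟨x.1, Finset.mem_filter.2 ⟨x.2, hx⟩⟩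
  simpa using LinearMap.finrank_le_finrank_of_injective hR

/-- An approximate eigenfunction which vanishes on the first two layers of each slab is zero. -/
lemma eq_zero_of_eq_zero_on_slab_layers {d : ℕ} (i : Fin d) {Vinf : ℝ} (V : (Fin d → ℤ) → ℝ)
    (hV : ∀ x, |V x| ≤ Vinf) {ε E : ℝ} (hε0 : 0 < ε) (hε : ε ≤ 1 / 2)
    (x₀ : Fin d → ℤ) (L : ℝ) {l : ℕ} (hl : 0 < l) {q : ℝ} (hq0 : 0 < q) (hq1 : q ≤ 1)
    (hq : q * (6 * ((2 * Vinf + 2 * 3 ^ d) ^ 2 + (3 ^ d) ^ 2)) ≤ 1)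
    (hεq : 6 * ε ^ 2 < q ^ l) (ψ : boxZ d x₀ L → ℂ)
    (hψ : Real.sqrt (∑ x, ‖ham d V (boxZ d x₀ L) ψ x - (E : ℂ) * ψ x‖ ^ 2) ≤
      ε * Real.sqrt (∑ x, ‖ψ x‖ ^ 2))
    (hzero : ∀ x : boxZ d x₀ L, slabRank i (x₀ i - ⌊L / 2⌋) l x.1 ≤ 1 → ψ x = 0) :
    ψ = 0 := by
  set η : boxZ d x₀ L → ℂ := fun x => ham d V (boxZ d x₀ L) ψ x - (E : ℂ) * ψ x with hηdef
  have hη : ∀ x, η x = -∑ y : boxZ d x₀ L with latticeAdj x.1 y.1, ψ y +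
      ((V x.1 - E : ℝ) : ℂ) * ψ x := fun x => by
    rw [hηdef]
    simp only [ham_apply]
    push_cast
    ring
  have hsmall : ∑ x, ‖η x‖ ^ 2 ≤ ε ^ 2 * ∑ x, ‖ψ x‖ ^ 2 := by
    have h := pow_le_pow_left₀ (Real.sqrt_nonneg _) hψ 2
    rwa [mul_pow, Real.sq_sqrt (Finset.sum_nonneg fun _ _ => by positivity),
      Real.sq_sqrt (Finset.sum_nonneg fun _ _ => by positivity)] at h
  have hrow : ∀ x : boxZ d x₀ L,
      ((Finset.univ.filter fun y : boxZ d x₀ L => latticeAdj x.1 y.1).card : ℝ) ≤ 3 ^ d :=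
    fun x => by exact_mod_cast card_latticeAdj_le _ x
  have hcol : ∀ y : boxZ d x₀ L,
      ((Finset.univ.filter fun x : boxZ d x₀ L => latticeAdj x.1 y.1).card : ℝ) ≤ 3 ^ d :=
    fun y => by simpa only [latticeAdj_comm (y := y.1)] using hrow y
  have hD : (1 : ℝ) ≤ 3 ^ d := one_le_pow₀ (by norm_num)
  by_cases hE : |E| ≤ Vinf + 2 * 3 ^ d
  · refine eq_zero_of_rank (fun x y : boxZ d x₀ L => latticeAdj x.1 y.1) hrow hcol _ ψ η hη
      (A := 2 * Vinf + 2 * 3 ^ d) (fun x => ?_) (fun x => slabRank i (x₀ i - ⌊L / 2⌋) l x.1)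
      (fun x => (Nat.mod_lt _ hl).le) (fun z hz => ?_) hq0 hq1 (by positivity) hq hεq hsmall
    · rw [Complex.norm_real, Real.norm_eq_abs]
      have := abs_sub (V x.1) E
      have := hV x.1
      linarith
    · refine exists_slab_predecessor i x₀ L hl z ?_
      by_contra h
      exact hz (hzero z (by omega))
  · refine eq_zero_of_large_potential (fun x y : boxZ d x₀ L => latticeAdj x.1 y.1) hD hrow hcol
      _ ψ η hη (fun x => ?_) hε0 hε hsmall
    rw [Complex.norm_real, Real.norm_eq_abs]
    have := abs_sub_abs_le_abs_sub E (V x.1)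
    rw [abs_sub_comm] at this
    have := hV x.1
    linarith

/-- For `d ≥ 1` and `‖V‖_∞ ≤ Vinf` there are constants `C, L₀ > 0`,
depending only on `d` and `Vinf`, such that for `0 < ε ≤ 1/2`, any `E`, `x₀`, any
`L ≥ L₀ log(1/ε)` and any linear subspace `F` of `ℓ²(Λ)`, `Λ = Λ_L(x₀)`, satisfying
`‖H_Λ ψ - E ψ‖_{ℓ²} ≤ ε ‖ψ‖_{ℓ²}` for all `ψ ∈ F`, one has `dim F ≤ C |Λ| / log(1/ε)`. -/
theorem discrete_approximate_eigenspace_dim_bound (d : ℕ) (hd : 1 ≤ d) (Vinf : ℝ) :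
    ∃ C > (0 : ℝ), ∃ L₀ > (0 : ℝ), ∀ V : (Fin d → ℤ) → ℝ, (∀ x, |V x| ≤ Vinf) →
      ∀ ε E : ℝ, 0 < ε → ε ≤ 1 / 2 → ∀ x₀ : Fin d → ℤ, ∀ L : ℝ,
        L₀ * Real.log (1 / ε) ≤ L →
        ∀ F : Submodule ℂ (↥(boxZ d x₀ L) → ℂ),
          (∀ ψ ∈ F,
            Real.sqrt (∑ x, ‖ham d V (boxZ d x₀ L) ψ x - (E : ℂ) * ψ x‖ ^ 2) ≤
              ε * Real.sqrt (∑ x, ‖ψ x‖ ^ 2)) →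
          (Module.finrank ℂ F : ℝ) ≤ C * (boxZ d x₀ L).card / Real.log (1 / ε) := by
  obtain ⟨B, hB⟩ : ∃ B : ℝ, B = 6 * ((2 * Vinf + 2 * 3 ^ d) ^ 2 + (3 ^ d) ^ 2) := ⟨_, rfl⟩
  have hD : (3 : ℝ) ≤ 3 ^ d := by
    simpa using pow_le_pow_right₀ (show (1 : ℝ) ≤ 3 by norm_num) hd
  have hB54 : 54 ≤ B := by nlinarith [sq_nonneg (2 * Vinf + 2 * 3 ^ d)]
  refine ⟨8 * B, by linarith, 1, one_pos, ?_⟩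
  intro V hV ε E hε0 hε x₀ L hL F hF
  set lam := Real.log (1 / ε) with hlam
  have hlam0 : 0 < lam := Real.log_pos (by rw [lt_div_iff₀ hε0]; linarith)
  have hexp : Real.exp (-lam) = ε := by
    rw [hlam, one_div, Real.log_inv, neg_neg, Real.exp_log hε0]
  rw [one_mul] at hL
  rw [le_div_iff₀ hlam0]
  rcases lt_or_ge lam B with hcase | hcase
  · have h1 : (Module.finrank ℂ F : ℝ) ≤ (boxZ d x₀ L).card := by
      have := Submodule.finrank_le F
      simp only [Module.finrank_fintype_fun_eq_card, Fintype.card_coe] at this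
      exact_mod_cast this
    have h2 : (0 : ℝ) ≤ (boxZ d x₀ L).card := by positivity
    nlinarith
  · obtain ⟨l, hl⟩ : ∃ l : ℕ, l = ⌊lam / B⌋₊ := ⟨_, rfl⟩
    have hB0 : 0 < B := by linarith
    have hl1 : 1 ≤ l := hl ▸ Nat.le_floor (by rw [Nat.cast_one, one_le_div hB0]; exact hcase)
    have hl1' : (1 : ℝ) ≤ l := by exact_mod_cast hl1
    have hlB : l * B ≤ lam := by
      rw [← le_div_iff₀ hB0, hl]
      exact Nat.floor_le (by positivity)
    have hlB2 : lam ≤ 2 * B * l := by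
      have := Nat.lt_floor_add_one (lam / B)
      rw [← hl, div_lt_iff₀ hB0] at this
      nlinarith
    have hexpB : B + 1 ≤ Real.exp B := Real.add_one_le_exp B
    have hq1 : Real.exp (-B) ≤ 1 := Real.exp_le_one_iff.2 (by linarith)
    have hqB : Real.exp (-B) * B ≤ 1 := by
      rw [Real.exp_neg, inv_mul_le_iff₀ (Real.exp_pos B)]
      linarith
    have hεB : ε ≤ Real.exp (-B) := hexp ▸ Real.exp_le_exp.2 (by linarith)
    have hεq : 6 * ε ^ 2 < Real.exp (-B) ^ l := by
      have h1 : ε ≤ Real.exp (-B) ^ l := by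
        rw [← Real.exp_nat_mul, ← hexp]
        exact Real.exp_le_exp.2 (by linarith)
      have h2 : 6 * ε < 1 := by nlinarith
      nlinarith
    have hdim := finrank_le_card_filter _
      (fun x => slabRank ⟨0, hd⟩ (x₀ ⟨0, hd⟩ - ⌊L / 2⌋) l x ≤ 1) F fun ψ hψ h0 =>
      eq_zero_of_eq_zero_on_slab_layers ⟨0, hd⟩ V hV (E := E) hε0 hε x₀ L hl1
        (Real.exp_pos (-B)) hq1 (hB ▸ hqB) hεq ψ (hF ψ hψ) h0
    have hfloor : 0 ≤ ⌊L / 2⌋ := Int.floor_nonneg.2 (by linarith)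
    have hcount := card_slab_layers_mul_le ⟨0, hd⟩ x₀ L l
    have hfl := Int.lt_floor_add_one (L / 2)
    obtain ⟨h, hh⟩ := Int.eq_ofNat_of_zero_le hfloor
    rw [hh] at hcount hfl hdim
    rw [show (2 * (h : ℤ) + 1).toNat = 2 * h + 1 by omega,
      show (2 * (h : ℤ)).toNat = 2 * h by omega] at hcount
    have hcount' := (Nat.mul_le_mul_right (2 * h + 1) hdim).trans hcount
    have hdiv : (((2 * h / l : ℕ) : ℝ)) * l ≤ 2 * h := by
      exact_mod_cast Nat.div_mul_le_self (2 * h) l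
    have hcountR : (Module.finrank ℂ F : ℝ) * (2 * h + 1) ≤
        (((2 * h / l : ℕ) : ℝ) + 1) * 2 * (boxZ d x₀ L).card := by
      exact_mod_cast hcount'
    have hnl : (l : ℝ) ≤ 2 * h + 1 := by
      push_cast at hfl
      nlinarith
    have hkey : (Module.finrank ℂ F : ℝ) * l ≤ 4 * (boxZ d x₀ L).card := by
      refine le_of_mul_le_mul_right ?_ (show (0 : ℝ) < 2 * h + 1 by positivity)
      calc (Module.finrank ℂ F : ℝ) * l * (2 * h + 1)
          = (Module.finrank ℂ F : ℝ) * (2 * h + 1) * l := by ring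
        _ ≤ (((2 * h / l : ℕ) : ℝ) + 1) * 2 * (boxZ d x₀ L).card * l := by gcongr
        _ = (((2 * h / l : ℕ) : ℝ) * l + l) * (2 * (boxZ d x₀ L).card) := by ring
        _ ≤ ((2 * h + 1) + (2 * h + 1)) * (2 * (boxZ d x₀ L).card) := by
          gcongr
          linarith
        _ = 4 * (boxZ d x₀ L).card * (2 * h + 1) := by ring
    calc (Module.finrank ℂ F : ℝ) * lam ≤ (Module.finrank ℂ F : ℝ) * (2 * B * l) := by gcongr
      _ = 2 * B * ((Module.finrank ℂ F : ℝ) * l) := by ring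
      _ ≤ 2 * B * (4 * (boxZ d x₀ L).card) := by gcongr
      _ = 8 * B * (boxZ d x₀ L).card := by ring
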